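/- Let f : U → ℝ³ with unit normal ν be a frontal in orthogonal adapted coordinates (u,v) around a pure-frontal singular point at the origin (Ñ(u,0) = 0 for all u), assume the origin is not an umbilic point (((1/3)·r_b(0) − κ_ν(0))² + 4·κ_t(0)² ≠ 0), and let V_j = (−v·(M̃ − κ_j·F̃))·∂_u + (L̃ − κ_j·Ẽ)·∂_v (j = 1,2) be the smoothly extended principal vector fields. Then there exist smooth maps e₁, e₂ : W → ℝ³ ∖ {0} on a neighborhood W of the origin such that ⟨e_j, e_k⟩ = δ_{jk} for 1 ≤ j,k ≤ 2 (δ the Kronecker delta) and, for each i ∈ {1,2} and each q ∈ W, the vectors e_i(q) and df_q(V_i(q)) are linearly dependent. -/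

import Mathlib

noncomputable section

open Matrix Set
open scoped ContDiff

abbrev V3 : Type := Fin 3 → ℝ

/-- Partial derivative in the `u`-direction. -/
def Du {E : Type*} [NormedAddCommGroup E] [NormedSpace ℝ E] (g : ℝ × ℝ → E) (p : ℝ × ℝ) : E :=
  fderiv ℝ g p (1, 0)

/-- Partial derivative in the `v`-direction. -/
def Dv {E : Type*} [NormedAddCommGroup E] [NormedSpace ℝ E] (g : ℝ × ℝ → E) (p : ℝ × ℝ) : E :=
  fderiv ℝ g p (0, 1)

def det3 (a b c : V3) : ℝ := Matrix.det (Matrix.of ![a, b, c])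

def dot (x y : V3) : ℝ := x ⬝ᵥ y

def nrm (x : V3) : ℝ := Real.sqrt (dot x x)

def cross3 (x y : V3) : V3 := crossProduct x y

structure FrontalData where
  f : ℝ × ℝ → V3
  nu : ℝ × ℝ → V3
  h : ℝ × ℝ → V3

namespace FrontalData

def Et (X : FrontalData) (p : ℝ × ℝ) : ℝ := dot (Du X.f p) (Du X.f p)
def Ft (X : FrontalData) (p : ℝ × ℝ) : ℝ := dot (Du X.f p) (X.h p)
def Gt (X : FrontalData) (p : ℝ × ℝ) : ℝ := dot (X.h p) (X.h p)
def Lt (X : FrontalData) (p : ℝ × ℝ) : ℝ := -(dot (Du X.f p) (Du X.nu p))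
def Mt (X : FrontalData) (p : ℝ × ℝ) : ℝ := -(dot (X.h p) (Du X.nu p))
def Nt (X : FrontalData) (p : ℝ × ℝ) : ℝ := -(dot (X.h p) (Dv X.nu p))

def EGF (X : FrontalData) (p : ℝ × ℝ) : ℝ := X.Et p * X.Gt p - (X.Ft p) ^ 2

/-- `f` is a frontal with unit normal `nu`, in adapted coordinates around a singular point of
the first kind at the origin: `f_v = v • h` and `{f_u, h, nu}` is a frame. -/
def IsAdapted (X : FrontalData) (U : Set (ℝ × ℝ)) : Prop :=
  IsOpen U ∧ (0, 0) ∈ U ∧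
  ContDiff ℝ ∞ X.f ∧ ContDiff ℝ ∞ X.nu ∧ ContDiff ℝ ∞ X.h ∧
  (∀ p ∈ U, dot (X.nu p) (X.nu p) = 1) ∧
  (∀ p ∈ U, dot (Du X.f p) (X.nu p) = 0) ∧
  (∀ p ∈ U, dot (Dv X.f p) (X.nu p) = 0) ∧
  (∀ p ∈ U, Dv X.f p = p.2 • X.h p) ∧
  (∀ p ∈ U, det3 (Du X.f p) (X.h p) (X.nu p) ≠ 0) ∧
  (∀ p ∈ U, 0 < X.EGF p)

/-- orthogonal adapted coordinates -/
def IsOrthogonal (X : FrontalData) (U : Set (ℝ × ℝ)) : Prop :=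
  ∀ u : ℝ, (u, 0) ∈ U → X.Et (u, 0) = 1 ∧ X.Gt (u, 0) = 1 ∧ X.Ft (u, 0) = 0

/-- Gaussian curvature on `{v ≠ 0}`. -/
def Kdef (X : FrontalData) (p : ℝ × ℝ) : ℝ :=
  (X.Lt p * X.Nt p - p.2 * (X.Mt p) ^ 2) / (p.2 * X.EGF p)

/-- Mean curvature on `{v ≠ 0}`. -/
def Hdef (X : FrontalData) (p : ℝ × ℝ) : ℝ :=
  (X.Et p * X.Nt p - 2 * p.2 * X.Ft p * X.Mt p + p.2 * X.Gt p * X.Lt p) / (2 * p.2 * X.EGF p)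

/-- Principal curvatures on `{v ≠ 0}`. -/
def kap1 (X : FrontalData) (p : ℝ × ℝ) : ℝ := X.Hdef p + Real.sqrt ((X.Hdef p) ^ 2 - X.Kdef p)
def kap2 (X : FrontalData) (p : ℝ × ℝ) : ℝ := X.Hdef p - Real.sqrt ((X.Hdef p) ^ 2 - X.Kdef p)

/-- Limiting normal curvature along the singular curve. -/
def kapNu (X : FrontalData) (u : ℝ) : ℝ := X.Lt (u, 0)
/-- Cuspidal torsion along the singular curve. -/
def kapT (X : FrontalData) (u : ℝ) : ℝ := X.Mt (u, 0)
/-- Bias along the singular curve. -/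
def rb (X : FrontalData) (u : ℝ) : ℝ := 3 * Dv X.Nt (u, 0)
/-- Secondary cuspidal curvature along the singular curve. -/
def rc (X : FrontalData) (u : ℝ) : ℝ :=
  12 * (Dv (Dv X.Nt) (u, 0) - 4 * Dv X.Ft (u, 0) * X.Mt (u, 0) -
    2 * Dv X.Gt (u, 0) * Dv X.Nt (u, 0))

end FrontalData

/-- Directional derivative of a map along the vector field `a ∂_u + ∂_v`. -/
def etaD (a : ℝ × ℝ → ℝ) (g : ℝ × ℝ → V3) : ℝ × ℝ → V3 :=
  fun p => a p • Du g p + Dv g p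

theorem dot_eq (x y : V3) : dot x y = x 0 * y 0 + x 1 * y 1 + x 2 * y 2 := by
  simp [dot, dotProduct, Fin.sum_univ_three]

theorem dot_self_pos {x : V3} (hx : x ≠ 0) : 0 < dot x x := by
  refine lt_of_le_of_ne (by rw [dot_eq]; simp only [← sq]; positivity) fun h => hx ?_
  rw [dot, eq_comm] at h
  exact dotProduct_self_eq_zero.mp h

theorem dot_smul_add_smul_left (a b : ℝ) (x y z : V3) :
    dot (a • x + b • y) z = a * dot x z + b * dot y z := by
  simp [dot, add_dotProduct, smul_dotProduct]

theorem dot_comm (x y : V3) : dot x y = dot y x := dotProduct_comm x y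

/-- Lagrange's identity. -/
theorem dot_cross3_self (a b : V3) :
    dot (cross3 a b) (cross3 a b) = dot a a * dot b b - dot a b ^ 2 := by
  simp only [dot_eq, cross3, cross_apply, Matrix.cons_val]
  ring

theorem dot_right_cross3 (a b : V3) : dot b (cross3 a b) = 0 := by
  simp only [dot_eq, cross3, cross_apply, Matrix.cons_val]
  ring

/-- A vector orthogonal to two orthonormal vectors is a multiple of their cross product. -/
theorem eq_dot_smul_cross3 {a b x : V3} (ha : dot a a = 1) (hb : dot b b = 1) (hab : dot a b = 0)
    (hxa : dot x a = 0) (hxb : dot x b = 0) : x = dot x (cross3 a b) • cross3 a b := by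
  have key : (dot a a * dot b b - dot a b ^ 2) • x =
      (dot x a * dot b b - dot x b * dot a b) • a +
      (dot x b * dot a a - dot x a * dot a b) • b + dot x (cross3 a b) • cross3 a b := by
    ext i
    fin_cases i <;>
      simp [dot_eq, cross3, cross_apply] <;> ring
  simpa [ha, hb, hab, hxa, hxb] using key

section Smoothness

variable {n : WithTop ℕ∞} {s : Set (ℝ × ℝ)}

theorem ContDiffOn.dot {g k : ℝ × ℝ → V3} (hg : ContDiffOn ℝ n g s) (hk : ContDiffOn ℝ n k s) :
    ContDiffOn ℝ n (fun p => dot (g p) (k p)) s := by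
  have hg' := contDiffOn_pi.mp hg
  have hk' := contDiffOn_pi.mp hk
  simp only [dot_eq]
  exact (((hg' 0).mul (hk' 0)).add ((hg' 1).mul (hk' 1))).add ((hg' 2).mul (hk' 2))

theorem ContDiffOn.cross3 {g k : ℝ × ℝ → V3} (hg : ContDiffOn ℝ n g s)
    (hk : ContDiffOn ℝ n k s) : ContDiffOn ℝ n (fun p => cross3 (g p) (k p)) s := by
  have hg' := contDiffOn_pi.mp hg
  have hk' := contDiffOn_pi.mp hk
  refine contDiffOn_pi.mpr fun i => ?_
  fin_cases i
  · simpa [_root_.cross3, cross_apply] using ((hg' 1).mul (hk' 2)).sub ((hg' 2).mul (hk' 1))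
  · simpa [_root_.cross3, cross_apply] using ((hg' 2).mul (hk' 0)).sub ((hg' 0).mul (hk' 2))
  · simpa [_root_.cross3, cross_apply] using ((hg' 0).mul (hk' 1)).sub ((hg' 1).mul (hk' 0))

theorem ContDiff.Du {g : ℝ × ℝ → V3} (hg : ContDiff ℝ ∞ g) : ContDiff ℝ ∞ (Du g) :=
  (hg.fderiv_right (m := ∞) le_rfl).clm_apply contDiff_const

theorem ContDiff.Dv {g : ℝ × ℝ → V3} (hg : ContDiff ℝ ∞ g) : ContDiff ℝ ∞ (Dv g) :=
  (hg.fderiv_right (m := ∞) le_rfl).clm_apply contDiff_const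

theorem ContDiff.dot {g k : ℝ × ℝ → V3} (hg : ContDiff ℝ n g) (hk : ContDiff ℝ n k) :
    ContDiff ℝ n (fun p => dot (g p) (k p)) :=
  contDiffOn_univ.mp (ContDiffOn.dot hg.contDiffOn hk.contDiffOn)

end Smoothness

/-- Let `w`, `w'` be smooth fields orthogonal to the unit field `nu`, and to each other off
`{v = 0}`.  Where `w ≠ 0`, normalizing `w` and rotating by a right angle about `nu` gives an
orthonormal pair parallel to `v • w` and `v • w'`. -/
theorem exists_orthonormal_pair {U : Set (ℝ × ℝ)} (hU : IsOpen U) {p : ℝ × ℝ} (hp : p ∈ U)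
    {nu w w' : ℝ × ℝ → V3} (hnu : ContDiffOn ℝ ∞ nu U) (hw : ContDiffOn ℝ ∞ w U)
    (hunit : ∀ q ∈ U, dot (nu q) (nu q) = 1) (hwnu : ∀ q ∈ U, dot (w q) (nu q) = 0)
    (hwnu' : ∀ q ∈ U, dot (w' q) (nu q) = 0)
    (hort : ∀ q ∈ U, q.2 ≠ 0 → dot (w q) (w' q) = 0) (h0 : w p ≠ 0) :
    ∃ W : Set (ℝ × ℝ), IsOpen W ∧ p ∈ W ∧ W ⊆ U ∧
      ∃ e e' : ℝ × ℝ → V3, ContDiffOn ℝ ∞ e W ∧ ContDiffOn ℝ ∞ e' W ∧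
        ∀ q ∈ W, dot (e q) (e q) = 1 ∧ dot (e' q) (e' q) = 1 ∧ dot (e q) (e' q) = 0 ∧
          (∃ c : ℝ, q.2 • w q = c • e q) ∧ (∃ c : ℝ, q.2 • w' q = c • e' q) := by
  let e : ℝ × ℝ → V3 := fun q => (Real.sqrt (dot (w q) (w q)))⁻¹ • w q
  let W := U ∩ w ⁻¹' {0}ᶜ
  have hWU : W ⊆ U := inter_subset_left
  have hpos : ∀ q ∈ W, 0 < dot (w q) (w q) := fun q hq => dot_self_pos hq.2
  have he : ContDiffOn ℝ ∞ e W :=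
    (((ContDiffOn.dot hw hw).mono hWU).sqrt fun q hq => (hpos q hq).ne').inv
      (fun q hq => (Real.sqrt_pos.mpr (hpos q hq)).ne') |>.smul (hw.mono hWU)
  refine ⟨W, hw.continuousOn.isOpen_inter_preimage hU isOpen_compl_singleton, ⟨hp, h0⟩, hWU,
    e, fun q => cross3 (nu q) (e q), he, ContDiffOn.cross3 (hnu.mono hWU) he, fun q hq => ?_⟩
  have hr : Real.sqrt (dot (w q) (w q)) ≠ 0 := (Real.sqrt_pos.mpr (hpos q hq)).ne'
  have hwe : w q = Real.sqrt (dot (w q) (w q)) • e q := by simp [e, smul_smul, hr]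
  have hee : dot (e q) (e q) = 1 := by
    have h := Real.mul_self_sqrt (hpos q hq).le
    have : dot (e q) (e q) = (Real.sqrt (dot (w q) (w q)))⁻¹ *
        ((Real.sqrt (dot (w q) (w q)))⁻¹ * dot (w q) (w q)) := by
      simp only [e, dot, smul_dotProduct, dotProduct_smul, smul_eq_mul]
    rw [this]
    field_simp
    rw [sq, h]
  have hne : dot (nu q) (e q) = 0 := by
    have := hwnu q hq.1
    simp only [dot] at this
    simp [e, dot, dotProduct_comm (nu q), this]
  refine ⟨hee, ?_, dot_right_cross3 _ _, ⟨q.2 * Real.sqrt (dot (w q) (w q)), ?_⟩, ?_⟩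
  · rw [dot_cross3_self, hunit q hq.1, hee, hne]
    norm_num
  · rw [mul_smul, ← hwe]
  · by_cases hv : q.2 = 0
    · exact ⟨0, by simp [hv]⟩
    · have hxe : dot (w' q) (e q) = 0 := by
        have := hort q hq.1 hv
        simp only [dot] at this
        simp [e, dot, dotProduct_comm (w' q), this]
      refine ⟨q.2 * dot (w' q) (cross3 (nu q) (e q)), ?_⟩
      rw [mul_smul, ← eq_dot_smul_cross3 (hunit q hq.1) hee hne (hwnu' q hq.1) hxe]

/-- The discriminant of the pencil of a definite and an arbitrary binary quadratic form is
nonnegative. -/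
theorem discrim_pencil_nonneg {E F G L M N : ℝ} (hE : 0 < E) (hD : 0 < E * G - F ^ 2) :
    0 ≤ (E * N - 2 * F * M + G * L) ^ 2 - 4 * (E * G - F ^ 2) * (L * N - M ^ 2) := by
  have h : (E * N - 2 * F * M + G * L) ^ 2 - 4 * (E * G - F ^ 2) * (L * N - M ^ 2) =
      4 * (E * G - F ^ 2) * ((E * M - F * L) / E) ^ 2 +
        (E * N - G * L - 2 * F / E * (E * M - F * L)) ^ 2 := by
    field_simp
    ring
  rw [h]
  positivity

namespace FrontalData

variable {X : FrontalData} {U : Set (ℝ × ℝ)}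

/-- The field with `df (V) = v • w` for the principal field `V` belonging to `k`. -/
def principalField (X : FrontalData) (k : ℝ × ℝ → ℝ) (p : ℝ × ℝ) : V3 :=
  (-(X.Mt p - k p * X.Ft p)) • Du X.f p + (X.Lt p - k p * X.Et p) • X.h p

theorem IsAdapted.smul_principalField (hA : X.IsAdapted U) (k : ℝ × ℝ → ℝ) {p : ℝ × ℝ}
    (hp : p ∈ U) :
    (-(p.2) * (X.Mt p - k p * X.Ft p)) • Du X.f p + (X.Lt p - k p * X.Et p) • Dv X.f p =
      p.2 • X.principalField k p := by
  obtain ⟨-, -, -, -, -, -, -, -, hfv, -, -⟩ := hA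
  rw [hfv p hp, principalField]
  module

theorem IsAdapted.dot_h_nu (hA : X.IsAdapted U) {p : ℝ × ℝ} (hp : p ∈ U) :
    dot (X.h p) (X.nu p) = 0 := by
  obtain ⟨hU, -, -, hnu, hh, -, -, hvn, hfv, -, -⟩ := hA
  have hdense : Dense {q : ℝ × ℝ | q.2 ≠ 0} :=
    (dense_compl_singleton (0 : ℝ)).preimage isOpenMap_snd
  have hclosed : IsClosed {q | dot (X.h q) (X.nu q) = 0} :=
    isClosed_eq (ContDiff.dot hh hnu).continuous continuous_const
  refine closure_minimal ?_ hclosed (hdense.open_subset_closure_inter hU hp)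
  rintro q ⟨hq, hv⟩
  have h := hvn q hq
  rw [hfv q hq, dot, smul_dotProduct, smul_eq_mul] at h
  exact (mul_eq_zero.mp h).resolve_left hv

theorem IsAdapted.dot_principalField_nu (hA : X.IsAdapted U) (k : ℝ × ℝ → ℝ) {p : ℝ × ℝ}
    (hp : p ∈ U) : dot (X.principalField k p) (X.nu p) = 0 := by
  rw [principalField, dot_smul_add_smul_left, hA.dot_h_nu hp, hA.2.2.2.2.2.2.1 p hp]
  simp

theorem dot_principalField (X : FrontalData) (k l : ℝ × ℝ → ℝ) (p : ℝ × ℝ) :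
    dot (X.principalField k p) (X.principalField l p) =
      (X.Mt p - k p * X.Ft p) * (X.Mt p - l p * X.Ft p) * X.Et p
        - (X.Mt p - k p * X.Ft p) * (X.Lt p - l p * X.Et p) * X.Ft p
        - (X.Lt p - k p * X.Et p) * (X.Mt p - l p * X.Ft p) * X.Ft p
        + (X.Lt p - k p * X.Et p) * (X.Lt p - l p * X.Et p) * X.Gt p := by
  rw [principalField, dot_smul_add_smul_left, dot_comm (Du X.f p), dot_comm (X.h p),
    principalField, dot_smul_add_smul_left, dot_smul_add_smul_left, dot_comm (X.h p) (Du X.f p)]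
  simp only [Et, Ft, Gt]
  ring

theorem Et_pos {p : ℝ × ℝ} (hD : 0 < X.EGF p) : 0 < X.Et p := by
  refine dot_self_pos fun h => ?_
  simp [EGF, Et, Ft, h, dot] at hD

/-- The discriminant `H² - K` in terms of the fundamental quantities. -/
theorem Hdef_sq_sub_Kdef {p : ℝ × ℝ} (hD : 0 < X.EGF p) (hv : p.2 ≠ 0) :
    4 * X.EGF p ^ 2 * (X.Hdef p ^ 2 - X.Kdef p) =
      (X.Et p * (X.Nt p / p.2) - 2 * X.Ft p * X.Mt p + X.Gt p * X.Lt p) ^ 2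
        - 4 * X.EGF p * (X.Lt p * (X.Nt p / p.2) - X.Mt p ^ 2) := by
  have := hD.ne'
  rw [Hdef, Kdef]
  field_simp
  ring

theorem Hdef_sq_sub_Kdef_nonneg {p : ℝ × ℝ} (hD : 0 < X.EGF p) (hv : p.2 ≠ 0) :
    0 ≤ X.Hdef p ^ 2 - X.Kdef p := by
  have h : 0 ≤ 4 * X.EGF p ^ 2 * (X.Hdef p ^ 2 - X.Kdef p) := by
    rw [Hdef_sq_sub_Kdef hD hv]
    exact discrim_pencil_nonneg (Et_pos hD) hD
  exact nonneg_of_mul_nonneg_right h (by positivity)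

theorem kap1_mul_kap2 {p : ℝ × ℝ} (hD : 0 < X.EGF p) (hv : p.2 ≠ 0) :
    X.kap1 p * X.kap2 p = X.Kdef p := by
  have := Real.mul_self_sqrt (Hdef_sq_sub_Kdef_nonneg hD hv)
  rw [kap1, kap2]
  linear_combination -this

theorem kap1_sub_kap2_sq {p : ℝ × ℝ} (hD : 0 < X.EGF p) (hv : p.2 ≠ 0) :
    X.EGF p ^ 2 * (X.kap1 p - X.kap2 p) ^ 2 =
      (X.Et p * (X.Nt p / p.2) - 2 * X.Ft p * X.Mt p + X.Gt p * X.Lt p) ^ 2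
        - 4 * X.EGF p * (X.Lt p * (X.Nt p / p.2) - X.Mt p ^ 2) := by
  have := Real.mul_self_sqrt (Hdef_sq_sub_Kdef_nonneg hD hv)
  rw [← Hdef_sq_sub_Kdef hD hv, kap1, kap2]
  linear_combination 4 * X.EGF p ^ 2 * this

theorem dot_principalField_eq_zero {k1 k2 : ℝ × ℝ → ℝ} {p : ℝ × ℝ} (hD : 0 < X.EGF p)
    (hv : p.2 ≠ 0) (h1 : k1 p = X.kap1 p) (h2 : k2 p = X.kap2 p) :
    dot (X.principalField k1 p) (X.principalField k2 p) = 0 := by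
  have hD' := hD.ne'
  have hK : X.EGF p * (k1 p * k2 p) = X.Lt p * (X.Nt p / p.2) - X.Mt p ^ 2 := by
    rw [h1, h2, kap1_mul_kap2 hD hv, Kdef]
    field_simp
  have hH : X.EGF p * (k1 p + k2 p) =
      X.Et p * (X.Nt p / p.2) - 2 * X.Ft p * X.Mt p + X.Gt p * X.Lt p := by
    rw [h1, h2, kap1, kap2, add_add_sub_cancel, Hdef]
    field_simp
    ring
  rw [dot_principalField]
  rw [EGF] at hK hH
  linear_combination X.Et p * hK - X.Lt p * hH

theorem IsAdapted.contDiff_fundamental (hA : X.IsAdapted U) :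
    ContDiff ℝ ∞ X.Et ∧ ContDiff ℝ ∞ X.Ft ∧ ContDiff ℝ ∞ X.Gt ∧ ContDiff ℝ ∞ X.Lt ∧
      ContDiff ℝ ∞ X.Mt ∧ ContDiff ℝ ∞ X.Nt := by
  obtain ⟨-, -, hf, hnu, hh, -⟩ := hA
  have hfu := ContDiff.Du hf
  have hnuu := ContDiff.Du hnu
  have hnuv := ContDiff.Dv hnu
  exact ⟨ContDiff.dot hfu hfu, ContDiff.dot hfu hh, ContDiff.dot hh hh,
    (ContDiff.dot hfu hnuu).neg, (ContDiff.dot hh hnuu).neg, (ContDiff.dot hh hnuv).neg⟩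

theorem IsAdapted.contDiffOn_principalField (hA : X.IsAdapted U) {k : ℝ × ℝ → ℝ}
    (hk : ContDiffOn ℝ ∞ k U) : ContDiffOn ℝ ∞ (X.principalField k) U := by
  obtain ⟨hE, hF, -, hL, hM, -⟩ := hA.contDiff_fundamental
  have hfu := ContDiff.Du hA.2.2.1
  have hh := hA.2.2.2.2.1
  exact ((hM.contDiffOn.sub (hk.mul hF.contDiffOn)).neg.smul hfu.contDiffOn).add
    ((hL.contDiffOn.sub (hk.mul hE.contDiffOn)).smul hh.contDiffOn)

/-- The extended principal curvatures satisfy `(k₁ - k₂)² = (r_b / 3 - κ_ν)² + 4 κ_t²` at the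
origin. -/
theorem IsAdapted.sub_sq_eq (hA : X.IsAdapted U) (hO : X.IsOrthogonal U)
    (hpure : X.Nt (0, 0) = 0) {k1 k2 : ℝ × ℝ → ℝ}
    (hk1 : ContinuousOn k1 U) (hk2 : ContinuousOn k2 U)
    (hk1e : ∀ p ∈ U, p.2 ≠ 0 → k1 p = X.kap1 p)
    (hk2e : ∀ p ∈ U, p.2 ≠ 0 → k2 p = X.kap2 p) :
    (k1 (0, 0) - k2 (0, 0)) ^ 2 =
      ((1 / 3) * X.rb 0 - X.kapNu 0) ^ 2 + 4 * (X.kapT 0) ^ 2 := by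
  obtain ⟨hE, hF, hG, hL, hM, hN⟩ := hA.contDiff_fundamental
  obtain ⟨hU, h0, -, -, -, -, -, -, -, -, hD⟩ := hA
  let γ : ℝ → ℝ × ℝ := fun v => (0, v)
  have hγ : Continuous γ := by fun_prop
  have along : ∀ {g : ℝ × ℝ → ℝ}, ContinuousAt g (0, 0) →
      Filter.Tendsto (fun v => g (γ v)) (nhdsWithin 0 {0}ᶜ) (nhds (g (0, 0))) := fun hg =>
    (Filter.Tendsto.comp hg (hγ.tendsto 0)).mono_left nhdsWithin_le_nhds
  have hn : Filter.Tendsto (fun v => X.Nt (γ v) / v) (nhdsWithin 0 {0}ᶜ)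
      (nhds (Dv X.Nt (0, 0))) := by
    have hd : HasDerivAt (fun v => X.Nt (γ v)) (Dv X.Nt (0, 0)) 0 :=
      ((hN.differentiable (by simp)).differentiableAt.hasFDerivAt (x := (0, 0))).comp_hasDerivAt
        (0 : ℝ) ((hasDerivAt_const (0 : ℝ) (0 : ℝ)).prodMk (hasDerivAt_id 0))
    have := hd.tendsto_slope
    refine this.congr fun v => ?_
    simp [slope_def_field, γ, hpure]
  have tE := along hE.continuous.continuousAt
  have tF := along hF.continuous.continuousAt
  have tG := along hG.continuous.continuousAt
  have tL := along hL.continuous.continuousAt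
  have tM := along hM.continuous.continuousAt
  have t1 := along (hk1.continuousAt (hU.mem_nhds h0))
  have t2 := along (hk2.continuousAt (hU.mem_nhds h0))
  have tD := (tE.mul tG).sub (tF.pow 2)
  have lhs := (tD.pow 2).mul ((t1.sub t2).pow 2)
  have rhs := ((((tE.mul hn).sub ((tF.const_mul 2).mul tM)).add (tG.mul tL)).pow 2).sub
    ((tD.const_mul 4).mul ((tL.mul hn).sub (tM.pow 2)))
  have hev : ∀ᶠ v in nhdsWithin (0 : ℝ) {0}ᶜ, γ v ∈ U ∧ v ≠ 0 :=
    ((hγ.tendsto 0).mono_left nhdsWithin_le_nhds |>.eventually (hU.mem_nhds h0)).and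
      self_mem_nhdsWithin
  have heq := tendsto_nhds_unique (lhs.congr' (hev.mono fun v hv => by
    have := kap1_sub_kap2_sq (hD _ hv.1) (p := γ v) hv.2
    rw [← hk1e _ hv.1 hv.2, ← hk2e _ hv.1 hv.2] at this
    exact this)) rhs
  obtain ⟨e0, g0, f0⟩ := hO 0 h0
  rw [e0, g0, f0] at heq
  rw [rb, kapNu, kapT]
  linear_combination heq

end FrontalData

/-- near a non-umbilic pure-frontal singular point there is a smooth orthonormal
pair `e₁, e₂` of nowhere vanishing maps with `df(V_i) ∥ e_i` pointwise. -/
theorem stmt11 (X : FrontalData) (U : Set (ℝ × ℝ))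
    (hA : X.IsAdapted U) (hO : X.IsOrthogonal U)
    (hpure : ∀ u : ℝ, (u, 0) ∈ U → X.Nt (u, 0) = 0)
    (humb : ((1 / 3) * X.rb 0 - X.kapNu 0) ^ 2 + 4 * (X.kapT 0) ^ 2 ≠ 0)
    (k1 k2 : ℝ × ℝ → ℝ)
    (hk1 : ContDiffOn ℝ ∞ k1 U) (hk2 : ContDiffOn ℝ ∞ k2 U)
    (hk1e : ∀ p ∈ U, p.2 ≠ 0 → k1 p = X.kap1 p)
    (hk2e : ∀ p ∈ U, p.2 ≠ 0 → k2 p = X.kap2 p) :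
    ∃ W : Set (ℝ × ℝ), IsOpen W ∧ (0, 0) ∈ W ∧ W ⊆ U ∧
      ∃ e1 e2 : ℝ × ℝ → V3, ContDiffOn ℝ ∞ e1 W ∧ ContDiffOn ℝ ∞ e2 W ∧
        ∀ q ∈ W,
          e1 q ≠ 0 ∧ e2 q ≠ 0 ∧
          dot (e1 q) (e1 q) = 1 ∧ dot (e2 q) (e2 q) = 1 ∧ dot (e1 q) (e2 q) = 0 ∧
          (∃ c : ℝ, (-(q.2) * (X.Mt q - k1 q * X.Ft q)) • Du X.f q +
              (X.Lt q - k1 q * X.Et q) • Dv X.f q = c • e1 q) ∧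
          (∃ c : ℝ, (-(q.2) * (X.Mt q - k2 q * X.Ft q)) • Du X.f q +
              (X.Lt q - k2 q * X.Et q) • Dv X.f q = c • e2 q) := by
  obtain ⟨hU, h0, -, hnu, -, hunit, -, -, -, -, hD⟩ := id hA
  have hort : ∀ q ∈ U, q.2 ≠ 0 →
      dot (X.principalField k1 q) (X.principalField k2 q) = 0 := fun q hq hv =>
    FrontalData.dot_principalField_eq_zero (hD q hq) hv (hk1e q hq hv) (hk2e q hq hv)
  have hne : ∀ {x : V3}, dot x x = 1 → x ≠ 0 := by
    rintro x hx rfl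
    simp [dot] at hx
  obtain ⟨hE, hG, hF⟩ := hO 0 h0
  have hw : X.principalField k1 (0, 0) ≠ 0 ∨ X.principalField k2 (0, 0) ≠ 0 := by
    by_contra! hzero
    have hsub := hA.sub_sq_eq hO (hpure 0 h0) hk1.continuousOn hk2.continuousOn hk1e hk2e
    have h1 := X.dot_principalField k1 k1 (0, 0)
    have h2 := X.dot_principalField k2 k2 (0, 0)
    rw [hzero.1, hE, hF, hG, dot, dotProduct_zero] at h1
    rw [hzero.2, hE, hF, hG, dot, dotProduct_zero] at h2
    have hL1 : X.Lt (0, 0) - k1 (0, 0) = 0 := by nlinarith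
    have hL2 : X.Lt (0, 0) - k2 (0, 0) = 0 := by nlinarith
    refine humb (hsub.symm.trans ?_)
    rw [← sub_sub_sub_cancel_left _ _ (X.Lt (0, 0)), hL1, hL2]
    norm_num
  rcases hw with hw | hw
  · obtain ⟨W, hWo, hW0, hWU, e, e', he, he', h⟩ := exists_orthonormal_pair hU h0
      hnu.contDiffOn (hA.contDiffOn_principalField hk1) hunit
      (fun q => hA.dot_principalField_nu k1) (fun q => hA.dot_principalField_nu k2) hort hw
    refine ⟨W, hWo, hW0, hWU, e, e', he, he', fun q hq => ?_⟩
    obtain ⟨h1, h2, h12, hc1, hc2⟩ := h q hq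
    rw [hA.smul_principalField k1 (hWU hq), hA.smul_principalField k2 (hWU hq)]
    exact ⟨hne h1, hne h2, h1, h2, h12, hc1, hc2⟩
  · obtain ⟨W, hWo, hW0, hWU, e, e', he, he', h⟩ := exists_orthonormal_pair hU h0
      hnu.contDiffOn (hA.contDiffOn_principalField hk2) hunit
      (fun q => hA.dot_principalField_nu k2) (fun q => hA.dot_principalField_nu k1)
      (fun q hq hv => (dot_comm _ _).trans (hort q hq hv)) hw
    refine ⟨W, hWo, hW0, hWU, e', e, he', he, fun q hq => ?_⟩
    obtain ⟨h2, h1, h21, hc2, hc1⟩ := h q hq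
    rw [hA.smul_principalField k1 (hWU hq), hA.smul_principalField k2 (hWU hq)]
    exact ⟨hne h1, hne h2, h1, h2, (dot_comm _ _).trans h21, hc1, hc2⟩
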